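/- arXiv:1505.04458 — 6 statements merged into one kernel-verified Lean document; each statement's English description precedes it below -/
import Mathlib

section
/- Let G be a finite simple graph on n vertices, n ≥ 1, and let p ∈ ℚ[x] be the unique polynomial such that for every positive integer t, p(t) equals the number of proper colorings of G with colors {1,…,t} (such a polynomial, the chromatic polynomial of G, exists and is unique). Then p(−1) = (−1)^n · a(G), the number of acyclic orientations of G up to sign. -/
open Finset

/-- `D` is an orientation of the simple graph `H`: for every edge `{a,b}` exactly one of
`D a b`, `D b a` holds, and `D a b` holds only if `{a,b}` is an edge. -/
def IsOrientation {V : Type*} (H : SimpleGraph V) (D : V → V → Prop) : Prop :=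
  (∀ a b, H.Adj a b → Xor' (D a b) (D b a)) ∧ (∀ a b, D a b → H.Adj a b)

/-- An orientation is acyclic if the transitive closure of `D` is irreflexive. -/
def IsAcyclicOrientation {V : Type*} (H : SimpleGraph V) (D : V → V → Prop) : Prop :=
  IsOrientation H D ∧ ∀ a, ¬ Relation.TransGen D a a

/-- `a(H)`: the number of acyclic orientations of `H`. -/
noncomputable def numAcyclicOrientations {V : Type*} (H : SimpleGraph V) : ℕ :=
  Nat.card {D : V → V → Prop // IsAcyclicOrientation H D}

section AcyclicOrientations

variable {V : Type*} [Fintype V] (G : SimpleGraph V)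

open scoped Classical in
/-- Proper colorings of the subgraph induced on `U` with colors `0, …, t - 1`, extended to all
vertices by the value `t` outside `U`. -/
noncomputable def coloringsOn (U : Finset V) (t : ℕ) : Finset (V → ℕ) :=
  {f ∈ Fintype.piFinset fun v => if v ∈ U then range t else {t} |
    ∀ a ∈ U, ∀ b ∈ U, G.Adj a b → f a ≠ f b}

/-- The graph on all vertices whose edges are the edges of `G` with both ends in `U`. -/
def edgesWithin {V : Type*} (G : SimpleGraph V) (U : Finset V) : SimpleGraph V where
  Adj a b := G.Adj a b ∧ a ∈ U ∧ b ∈ U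
  symm := ⟨fun _ _ h => ⟨h.1.symm, h.2.2, h.2.1⟩⟩
  loopless := ⟨fun _ h => h.1.ne rfl⟩

open scoped Classical in
/-- Acyclic orientations of the subgraph induced on `U`. -/
noncomputable def acyclicOrientationsOn (U : Finset V) : Finset (V → V → Prop) :=
  {D | IsAcyclicOrientation (edgesWithin G U) D}

open scoped Classical in
/-- The independent subsets of `U`. -/
noncomputable def independentSubsets (U : Finset V) : Finset (Finset V) :=
  {S ∈ U.powerset | ∀ a ∈ S, ∀ b ∈ S, ¬ G.Adj a b}

open scoped Classical in
/-- The vertices of `U` without outgoing edges. -/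
noncomputable def sinksIn (U : Finset V) (D : V → V → Prop) : Finset V :=
  {v ∈ U | ∀ w, ¬ D v w}

variable {G} in
theorem mem_coloringsOn {U : Finset V} {t : ℕ} {f : V → ℕ} :
    f ∈ coloringsOn G U t ↔ (∀ v ∈ U, f v < t) ∧ (∀ v ∉ U, f v = t) ∧
      ∀ a ∈ U, ∀ b ∈ U, G.Adj a b → f a ≠ f b := by
  simp only [coloringsOn, mem_filter, Fintype.mem_piFinset]
  rw [← and_assoc]
  refine and_congr_left fun _ => ⟨fun h => ⟨fun v hv => ?_, fun v hv => ?_⟩, fun h v => ?_⟩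
  · simpa [hv] using h v
  · simpa [hv] using h v
  · by_cases hv : v ∈ U
    · simpa [hv] using h.1 v hv
    · simpa [hv] using h.2 v hv

variable {G} in
theorem mem_acyclicOrientationsOn {U : Finset V} {D : V → V → Prop} :
    D ∈ acyclicOrientationsOn G U ↔ IsAcyclicOrientation (edgesWithin G U) D := by
  simp [acyclicOrientationsOn]

variable {G} in
theorem mem_independentSubsets {U S : Finset V} :
    S ∈ independentSubsets G U ↔ S ⊆ U ∧ ∀ a ∈ S, ∀ b ∈ S, ¬ G.Adj a b := by
  simp [independentSubsets]

theorem mem_sinksIn {U : Finset V} {D : V → V → Prop} {v : V} :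
    v ∈ sinksIn U D ↔ v ∈ U ∧ ∀ w, ¬ D v w := by
  simp [sinksIn]

open scoped Classical in
theorem card_coloringsOn_succ (U : Finset V) (t : ℕ) :
    #(coloringsOn G U (t + 1)) = ∑ S ∈ independentSubsets G U, #(coloringsOn G (U \ S) t) := by
  rw [card_eq_sum_card_fiberwise (f := fun f : V → ℕ => {v ∈ U | f v = t})
    (t := independentSubsets G U)]
  · refine sum_congr rfl fun S hS => ?_
    obtain ⟨hSU, hSi⟩ := mem_independentSubsets.1 hS
    refine card_nbij' (fun f v => min (f v) t) (fun g v => if v ∈ U then g v else t + 1)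
      ?_ ?_ ?_ ?_
    · intro f hf
      simp only [coe_filter, Set.mem_ofPred_eq, mem_coloringsOn, mem_coe, mem_sdiff] at hf ⊢
      obtain ⟨⟨h1, h2, h3⟩, rfl⟩ := hf
      simp only [mem_filter]
      refine ⟨fun v hv => ?_, fun v hv => ?_, fun a ha b hb hab => ?_⟩
      · have := h1 v hv.1
        grind
      · by_cases hv' : v ∈ U
        · grind
        · grind
      · have := h1 a ha.1
        have := h1 b hb.1
        have := h3 a ha.1 b hb.1 hab
        grind
    · intro g hg
      simp only [coe_filter, Set.mem_ofPred_eq, mem_coloringsOn, mem_coe, mem_sdiff] at hg ⊢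
      obtain ⟨h1, h2, h3⟩ := hg
      refine ⟨⟨fun v hv => ?_, fun v hv => ?_, fun a ha b hb hab => ?_⟩, ?_⟩
      · have := h1 v
        have := h2 v
        grind
      · grind
      · have := h1 a
        have := h2 a
        have := h1 b
        have := h2 b
        have := hSi a
        have := h3 a
        rw [if_pos ha, if_pos hb]
        by_cases ha' : a ∈ S <;> by_cases hb' : b ∈ S
        · exact absurd hab (hSi a ha' b hb')
        · grind
        · grind
        · exact h3 a ⟨ha, ha'⟩ b ⟨hb, hb'⟩ hab
      · ext v
        have := h1 v
        have := h2 v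
        have := @hSU v
        grind
    · intro f hf
      simp only [coe_filter, Set.mem_ofPred_eq, mem_coloringsOn] at hf
      ext v
      have := hf.1.1 v
      have := hf.1.2.1 v
      grind
    · intro g hg
      simp only [mem_coloringsOn, mem_coe, mem_sdiff] at hg
      ext v
      have := hg.1 v
      have := hg.2.1 v
      grind
  · intro f hf
    simp only [mem_coe, mem_coloringsOn] at hf
    refine mem_independentSubsets.2 ⟨filter_subset _ _, fun a ha b hb hab => ?_⟩
    rw [mem_filter] at ha hb
    exact hf.2.2 a ha.1 b hb.1 hab (ha.2.trans hb.2.symm)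

open scoped Classical in
theorem card_filter_subset_sinksIn {U S : Finset V} (hS : S ∈ independentSubsets G U) :
    #{D ∈ acyclicOrientationsOn G U | S ⊆ sinksIn U D} =
      #(acyclicOrientationsOn G (U \ S)) := by
  obtain ⟨hSU, hSi⟩ := mem_independentSubsets.1 hS
  refine card_nbij' (fun D a b => D a b ∧ b ∉ S)
    (fun D a b => D a b ∨ (a ∈ U ∧ a ∉ S ∧ b ∈ S ∧ G.Adj a b)) ?_ ?_ ?_ ?_
  · intro D hD
    simp only [coe_filter, Set.mem_ofPred_eq, mem_acyclicOrientationsOn, mem_coe] at hD ⊢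
    obtain ⟨⟨⟨hx, he⟩, hac⟩, hs⟩ := hD
    have hs' : ∀ a ∈ S, ∀ b, ¬ D a b := fun a ha => (mem_sinksIn.1 (hs ha)).2
    refine ⟨⟨fun a b hab => ?_, fun a b hab => ?_⟩, fun a ha => ?_⟩
    · obtain ⟨h, ha, hb⟩ := hab
      rw [mem_sdiff] at ha hb
      simpa [ha.2, hb.2] using hx a b ⟨h, ha.1, hb.1⟩
    · obtain ⟨h, ha, hb⟩ := he a b hab.1
      exact ⟨h, mem_sdiff.2 ⟨ha, fun h' => hs' a h' b hab.1⟩, mem_sdiff.2 ⟨hb, hab.2⟩⟩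
    · exact hac a (Relation.TransGen.mono (fun _ _ h => h.1) _ _ ha)
  · intro D hD
    simp only [coe_filter, Set.mem_ofPred_eq, mem_acyclicOrientationsOn, mem_coe] at hD ⊢
    obtain ⟨⟨hx, he⟩, hac⟩ := hD
    have he' : ∀ a b, D a b → G.Adj a b ∧ (a ∈ U ∧ a ∉ S) ∧ (b ∈ U ∧ b ∉ S) := fun a b h => by
      have := he a b h
      simpa only [edgesWithin, mem_sdiff] using this
    refine ⟨⟨⟨fun a b hab => ?_, fun a b hab => ?_⟩, fun a ha => ?_⟩, fun a ha => ?_⟩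
    · obtain ⟨h, ha, hb⟩ := hab
      have h1 := he' a b
      have h2 := he' b a
      have h3 := hSi a
      have h4 := h.symm
      by_cases ha' : a ∈ S
      · have hb' : b ∉ S := fun hb' => h3 ha' b hb' h
        tauto
      · by_cases hb' : b ∈ S
        · tauto
        · simpa [ha', hb'] using hx a b ⟨h, mem_sdiff.2 ⟨ha, ha'⟩, mem_sdiff.2 ⟨hb, hb'⟩⟩
    · rcases hab with hab | ⟨h1, h2, h3, h4⟩
      · have := he' a b hab
        exact ⟨this.1, this.2.1.1, this.2.2.1⟩
      · exact ⟨h4, h1, hSU h3⟩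
    · have key : ∀ a b, Relation.TransGen
          (fun a b => D a b ∨ (a ∈ U ∧ a ∉ S ∧ b ∈ S ∧ G.Adj a b)) a b →
          a ∉ S ∧ (b ∉ S → Relation.TransGen D a b) := by
        intro a b h
        induction h with
        | single h =>
          rcases h with h | h
          · exact ⟨(he' _ _ h).2.1.2, fun _ => .single h⟩
          · exact ⟨h.2.1, fun h' => (h' h.2.2.1).elim⟩
        | tail _ h ih =>
          refine ⟨ih.1, fun hb => ?_⟩
          rcases h with h | h
          · exact (ih.2 (he' _ _ h).2.1.2).tail h
          · exact (hb h.2.2.1).elim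
      exact hac a ((key a a ha).2 (key a a ha).1)
    · refine mem_sinksIn.2 ⟨hSU ha, fun w hw => ?_⟩
      rcases hw with hw | hw
      · exact (he' _ _ hw).2.1.2 ha
      · exact hw.2.1 ha
  · intro D hD
    simp only [coe_filter, Set.mem_ofPred_eq, mem_acyclicOrientationsOn] at hD
    obtain ⟨⟨⟨hx, he⟩, hac⟩, hs⟩ := hD
    have hs' : ∀ a ∈ S, ∀ b, ¬ D a b := fun a ha => (mem_sinksIn.1 (hs ha)).2
    ext a b
    have h1 : D a b → G.Adj a b ∧ a ∈ U ∧ b ∈ U := he a b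
    have h2 : G.Adj a b ∧ a ∈ U ∧ b ∈ U → Xor (D a b) (D b a) := hx a b
    have h3 := hs' a
    have h4 := hs' b
    have h5 := @hSU b
    constructor
    · rintro (h | ⟨ha, ha', hb, hab⟩)
      · exact h.1
      · exact (h2 ⟨hab, ha, h5 hb⟩).elim (fun h => h.1) fun h => (h4 hb a h.1).elim
    · intro h
      by_cases hb : b ∈ S
      · exact .inr ⟨(h1 h).2.1, fun ha => h3 ha b h, hb, (h1 h).1⟩
      · exact .inl ⟨h, hb⟩
  · intro D hD
    simp only [mem_acyclicOrientationsOn, mem_coe] at hD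
    ext a b
    have h1 : D a b → b ∉ S := fun h => (mem_sdiff.1 (hD.1.2 a b h).2.2).2
    simp only
    tauto

theorem sinksIn_nonempty {U : Finset V} (hU : U.Nonempty) {D : V → V → Prop}
    (hD : D ∈ acyclicOrientationsOn G U) : (sinksIn U D).Nonempty := by
  rw [mem_acyclicOrientationsOn] at hD
  have : Std.Irrefl (flip (Relation.TransGen D)) := ⟨hD.2⟩
  have : IsTrans V (flip (Relation.TransGen D)) := ⟨fun _ _ _ h1 h2 => h2.trans h1⟩
  have hwf := Finite.wellFounded_of_trans_of_irrefl (flip (Relation.TransGen D))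
  obtain ⟨m, hm, hmin⟩ := hwf.has_min (U : Set V) hU
  exact ⟨m, mem_sinksIn.2 ⟨hm, fun w hw => hmin w (hD.1.2 m w hw).2.2 (.single hw)⟩⟩

theorem mem_independentSubsets_of_subset_sinksIn {U : Finset V} {D : V → V → Prop}
    (hD : D ∈ acyclicOrientationsOn G U) {S : Finset V} (hS : S ⊆ sinksIn U D) :
    S ∈ independentSubsets G U := by
  rw [mem_acyclicOrientationsOn] at hD
  have h : ∀ a ∈ S, a ∈ U ∧ ∀ w, ¬ D a w := fun a ha => mem_sinksIn.1 (hS ha)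
  refine mem_independentSubsets.2 ⟨fun a ha => (h a ha).1, fun a ha b hb hab => ?_⟩
  exact (hD.1.1 a b ⟨hab, (h a ha).1, (h b hb).1⟩).elim
    (fun h' => (h a ha).2 b h'.1) fun h' => (h b hb).2 a h'.1

open scoped Classical in
theorem sum_independentSubsets_card_acyclicOrientationsOn {U : Finset V} (hU : U.Nonempty) :
    ∑ S ∈ independentSubsets G U, (-1 : ℤ) ^ #S * #(acyclicOrientationsOn G (U \ S)) = 0 := by
  calc
    _ = ∑ S ∈ independentSubsets G U, ∑ D ∈ acyclicOrientationsOn G U,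
          if S ⊆ sinksIn U D then (-1 : ℤ) ^ #S else 0 := by
      refine sum_congr rfl fun S hS => ?_
      rw [← card_filter_subset_sinksIn G hS, ← sum_filter, sum_const, nsmul_eq_mul, mul_comm]
    _ = ∑ D ∈ acyclicOrientationsOn G U, ∑ S ∈ (sinksIn U D).powerset, (-1 : ℤ) ^ #S := by
      rw [sum_comm]
      refine sum_congr rfl fun D hD => ?_
      rw [← sum_filter]
      refine sum_congr ?_ fun _ _ => rfl
      ext S
      simp only [mem_filter, mem_powerset, and_iff_right_iff_imp]
      exact mem_independentSubsets_of_subset_sinksIn G hD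
    _ = 0 := by
      refine sum_eq_zero fun D hD => ?_
      rw [sum_powerset_neg_one_pow_card, if_neg (sinksIn_nonempty G hU hD).ne_empty]

theorem exists_polynomial_eval_eq_sum_range (q : Polynomial ℚ) :
    ∃ p : Polynomial ℚ, ∀ n : ℕ, p.eval (n : ℚ) = ∑ k ∈ range n, q.eval (k : ℚ) := by
  induction q using Polynomial.induction_on' with
  | add q r hq hr =>
    obtain ⟨p, hp⟩ := hq
    obtain ⟨p', hp'⟩ := hr
    exact ⟨p + p', fun n => by simp [hp, hp', sum_add_distrib]⟩
  | monomial m a =>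
    refine ⟨Polynomial.C (a / (m + 1)) *
      (Polynomial.bernoulli m.succ - Polynomial.C (_root_.bernoulli m.succ)), fun n => ?_⟩
    have h := Polynomial.sum_range_pow_eq_bernoulli_sub n m
    have hm : (m : ℚ) + 1 ≠ 0 := by positivity
    simp only [Polynomial.eval_mul, Polynomial.eval_C, Polynomial.eval_sub,
      Polynomial.eval_monomial, ← mul_sum, ← h]
    field_simp

theorem eval_add_one_sub_eval_of_sum_range {p q : Polynomial ℚ}
    (h : ∀ n : ℕ, p.eval (n : ℚ) = ∑ k ∈ range n, q.eval (k : ℚ)) (x : ℚ) :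
    p.eval (x + 1) - p.eval x = q.eval x := by
  have : p.comp (Polynomial.X + 1) - p = q := by
    refine Polynomial.eq_of_infinite_eval_eq _ _ (Set.Infinite.mono ?_
      (Set.infinite_range_of_injective (Nat.cast_injective (R := ℚ))))
    rintro _ ⟨n, rfl⟩
    have h1 := h (n + 1)
    rw [sum_range_succ, ← h n] at h1
    push_cast at h1
    simp [h1]
  simpa using congrArg (Polynomial.eval x) this

theorem card_coloringsOn_empty (t : ℕ) : #(coloringsOn G ∅ t) = 1 := by
  rw [card_eq_one]
  refine ⟨fun _ => t, ?_⟩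
  ext f
  simp [mem_coloringsOn, funext_iff]

theorem card_acyclicOrientationsOn_empty : #(acyclicOrientationsOn G ∅) = 1 := by
  rw [card_eq_one]
  refine ⟨fun _ _ => False, ?_⟩
  ext D
  rw [mem_acyclicOrientationsOn, mem_singleton]
  constructor
  · intro h
    ext a b
    exact ⟨fun hab => by simpa [edgesWithin] using h.1.2 a b hab, False.elim⟩
  · rintro rfl
    refine ⟨⟨fun a b h => by simp [edgesWithin] at h, fun a b h => h.elim⟩, fun a h => ?_⟩
    obtain ⟨_, _, h⟩ := Relation.TransGen.tail'_iff.1 h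
    exact h

theorem card_coloringsOn_zero {U : Finset V} (hU : U.Nonempty) : #(coloringsOn G U 0) = 0 := by
  obtain ⟨v, hv⟩ := hU
  refine card_eq_zero.2 (eq_empty_of_forall_notMem fun f hf => ?_)
  exact absurd ((mem_coloringsOn.1 hf).1 v hv) (Nat.not_lt_zero _)

theorem empty_mem_independentSubsets (U : Finset V) : ∅ ∈ independentSubsets G U := by
  simp [mem_independentSubsets]

/-- The chromatic polynomial of the subgraph induced on `U`, with its value at `-1`. -/
theorem exists_chromatic_polynomial (U : Finset V) :
    ∃ p : Polynomial ℚ, (∀ t : ℕ, p.eval (t : ℚ) = #(coloringsOn G U t)) ∧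
      p.eval (-1) = (-1) ^ #U * #(acyclicOrientationsOn G U) := by
  classical
  induction U using Finset.strongInduction with
  | H U ih =>
  rcases U.eq_empty_or_nonempty with rfl | hU
  · exact ⟨1, by simp [card_coloringsOn_empty], by simp [card_acyclicOrientationsOn_empty]⟩
  have hsub : ∀ S ∈ (independentSubsets G U).erase ∅, S ⊆ U ∧ U \ S ⊂ U := by
    intro S hS
    rw [mem_erase] at hS
    have hSU : S ⊆ U := (mem_independentSubsets.1 hS.2).1
    exact ⟨hSU, sdiff_ssubset hSU (nonempty_iff_ne_empty.2 hS.1)⟩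
  choose! P hP hP1 using ih
  obtain ⟨p, hp⟩ := exists_polynomial_eval_eq_sum_range
    (∑ S ∈ (independentSubsets G U).erase ∅, P (U \ S))
  refine ⟨p, fun t => ?_, ?_⟩
  · rw [hp]
    induction t with
    | zero => simp [card_coloringsOn_zero G hU]
    | succ t iht =>
      rw [sum_range_succ, iht, card_coloringsOn_succ,
        ← add_sum_erase _ _ (empty_mem_independentSubsets G U), Polynomial.eval_finsetSum]
      push_cast
      rw [sdiff_empty]
      exact congrArg _ (sum_congr rfl fun S hS => hP _ (hsub S hS).2 t)
  · have h := eval_add_one_sub_eval_of_sum_range hp (-1)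
    have h0 : p.eval 0 = 0 := by simpa using hp 0
    rw [neg_add_cancel, h0, Polynomial.eval_finsetSum] at h
    have ha := congrArg (Int.cast : ℤ → ℚ)
      (sum_independentSubsets_card_acyclicOrientationsOn G hU)
    push_cast at ha
    rw [← add_sum_erase _ _ (empty_mem_independentSubsets G U), sdiff_empty, card_empty,
      pow_zero, one_mul] at ha
    have hs : ∑ S ∈ (independentSubsets G U).erase ∅, (P (U \ S)).eval (-1) =
        (-1) ^ #U * ∑ S ∈ (independentSubsets G U).erase ∅,
          (-1) ^ #S * (#(acyclicOrientationsOn G (U \ S)) : ℚ) := by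
      rw [mul_sum]
      refine sum_congr rfl fun S hS => ?_
      rw [hP1 _ (hsub S hS).2, ← card_sdiff_add_card_eq_card (hsub S hS).1, pow_add, mul_assoc,
        ← mul_assoc ((-1) ^ #S), ← mul_pow]
      simp
    rw [hs] at h
    linear_combination -h - (-1) ^ #U * ha

theorem card_coloringsOn_univ (t : ℕ) :
    #(coloringsOn G univ t) = Nat.card {f : V → Fin t // ∀ a b, G.Adj a b → f a ≠ f b} := by
  rw [← Nat.card_eq_finsetCard]
  symm
  refine Nat.card_congr
    { toFun := fun f => ⟨fun v => f.1 v, mem_coloringsOn.2 ⟨fun v _ => (f.1 v).2,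
        fun v hv => (hv (mem_univ v)).elim, fun a _ b _ hab h => f.2 a b hab (Fin.ext h)⟩⟩
      invFun := fun f => ⟨fun v => ⟨f.1 v, (mem_coloringsOn.1 f.2).1 v (mem_univ v)⟩,
        fun a b hab h => (mem_coloringsOn.1 f.2).2.2 a (mem_univ a) b (mem_univ b) hab
          (Fin.mk.inj h)⟩
      left_inv := fun _ => rfl
      right_inv := fun _ => rfl }

theorem card_acyclicOrientationsOn_univ :
    #(acyclicOrientationsOn G univ) = numAcyclicOrientations G := by
  classical
  have : edgesWithin G univ = G := by
    ext a b
    simp [edgesWithin]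
  rw [acyclicOrientationsOn, this, numAcyclicOrientations, Nat.card_eq_fintype_card,
    Fintype.card_subtype]

end AcyclicOrientations

/-- Stanley's theorem: the chromatic polynomial of a graph evaluated at `-1` equals
`(-1)^n` times the number of acyclic orientations. -/
theorem stmt2 {V : Type*} [Fintype V] [Nonempty V] (G : SimpleGraph V)
    (p : Polynomial ℚ)
    (hp : ∀ t : ℕ, 0 < t → p.eval (t : ℚ) =
      Nat.card {f : V → Fin t // ∀ a b, G.Adj a b → f a ≠ f b}) :
    p.eval (-1) = (-1) ^ Fintype.card V * numAcyclicOrientations G := by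
  classical
  obtain ⟨q, hq, hq1⟩ := exists_chromatic_polynomial G univ
  have hpq : p = q := by
    refine Polynomial.eq_of_infinite_eval_eq p q (Set.Infinite.mono ?_
      (Set.infinite_range_of_injective
        (Nat.cast_injective.comp (add_left_injective 1) : Function.Injective
          ((Nat.cast : ℕ → ℚ) ∘ (· + 1)))))
    rintro _ ⟨t, rfl⟩
    have h := hp (t + 1) t.succ_pos
    rw [← card_coloringsOn_univ, ← hq] at h
    exact h
  rw [hpq, hq1, card_acyclicOrientationsOn_univ, card_univ]
end

section
/- Let Γ be a simplicial complex on a finite vertex set V with |V| = n ≥ 1, and let s ≥ 1 be an integer. Then there exists a polynomial p ∈ ℚ[x] of degree n such that for every positive integer t, p(t) equals the number of s-simplicial colorings of Γ with colors {1,…,t}. (In other words, the s-chromatic function χ_s(Γ;t) is a polynomial in t.) -/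
open Finset

/-- `Γ` is an (abstract) simplicial complex on the vertex type `V`: a collection of finite
subsets of `V` closed under taking subsets and containing every singleton. -/
def IsSimplicialComplex {V : Type*} (Γ : Finset (Finset V)) : Prop :=
  (∀ X ∈ Γ, ∀ Y ⊆ X, Y ∈ Γ) ∧ ∀ v : V, {v} ∈ Γ

/-- The dimension of a simplicial complex, as an integer: one less than the maximal
cardinality of a face. -/
def dimSC {V : Type*} (Γ : Finset (Finset V)) : ℤ :=
  ((Γ.sup Finset.card : ℕ) : ℤ) - 1

/-- The induced simplicial complex `Γ_T`, whose faces are `{X ∩ T : X ∈ Γ}`. -/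
def inducedSC {V : Type*} [DecidableEq V] (Γ : Finset (Finset V)) (T : Finset V) :
    Finset (Finset V) :=
  Γ.image (fun X => X ∩ T)

/-- An `s`-simplicial coloring: every face uses each color at most `s` times. -/
def IsSColoring {V : Type*} [DecidableEq V] {C : Type*} [DecidableEq C]
    (Γ : Finset (Finset V)) (s : ℕ) (f : V → C) : Prop :=
  ∀ X ∈ Γ, ∀ c : C, (X.filter (fun v => f v = c)).card ≤ s

/-- Relabelling the colors injectively does not affect whether a coloring is `s`-simplicial. -/
theorem isSColoring_comp_iff {V C D : Type*} [DecidableEq V] [DecidableEq C] [DecidableEq D]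
    (Γ : Finset (Finset V)) (s : ℕ) (h : V → C) {g : C → D} (hg : Function.Injective g) :
    IsSColoring Γ s (g ∘ h) ↔ IsSColoring Γ s h := by
  refine forall₂_congr fun X _ => ⟨fun H c => ?_, fun H d => ?_⟩
  · simpa [hg.eq_iff] using H (g c)
  · by_cases hd : ∃ c, g c = d
    · obtain ⟨c, rfl⟩ := hd
      simpa [hg.eq_iff] using H c
    · push Not at hd
      simp [hd]

theorem isSColoring_of_injective {V C : Type*} [DecidableEq V] {_ : DecidableEq C}
    (Γ : Finset (Finset V)) {s : ℕ} (hs : 1 ≤ s) {f : V → C} (hf : Function.Injective f) :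
    IsSColoring Γ s f := by
  intro X _ c
  refine le_trans (Finset.card_le_one.2 fun a ha b hb => hf ?_) hs
  rw [(Finset.mem_filter.1 ha).2, (Finset.mem_filter.1 hb).2]

/-- Functions with kernel `r` are embeddings of the quotient by `r`. -/
def kerEqEquivEmbedding {V C : Type*} (r : Setoid V) :
    {f : V → C // Setoid.ker f = r} ≃ (Quotient r ↪ C) where
  toFun f := ⟨Quotient.lift f.1 fun a b hab => by
      have h : Setoid.ker f.1 a b := by rw [f.2]; exact hab
      exact h, by
    rintro ⟨a⟩ ⟨b⟩ hab
    apply Quotient.sound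
    have h : Setoid.ker f.1 a b := hab
    rwa [f.2] at h⟩
  invFun g := ⟨fun v => g (Quotient.mk r v), by
    ext a b
    rw [Setoid.ker_def, g.injective.eq_iff]
    exact Quotient.eq⟩
  left_inv _ := rfl
  right_inv g := by
    ext ⟨a⟩
    rfl

open Classical in
theorem isSColoring_iff_of_ker_eq {V C : Type*} [DecidableEq V] [DecidableEq C]
    (Γ : Finset (Finset V)) (s : ℕ) {r : Setoid V} (f : V → C) (hf : Setoid.ker f = r) :
    IsSColoring Γ s f ↔ IsSColoring Γ s (Quotient.mk r) :=
  isSColoring_comp_iff Γ s (Quotient.mk r) (kerEqEquivEmbedding r ⟨f, hf⟩).injective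

theorem natCard_ker_eq {V : Type*} [Finite V] (r : Setoid V) (t : ℕ) :
    Nat.card {f : V → Fin t // Setoid.ker f = r} = t.descFactorial (Nat.card (Quotient r)) := by
  classical
  have := Fintype.ofFinite (Quotient r)
  rw [Nat.card_congr (kerEqEquivEmbedding r), Nat.card_eq_fintype_card,
    Fintype.card_embedding_eq, Fintype.card_fin, Nat.card_eq_fintype_card]

theorem natCard_quotient_lt {V : Type*} [Finite V] {r : Setoid V} (hr : r ≠ ⊥) :
    Nat.card (Quotient r) < Nat.card V := by
  by_contra! h
  refine hr (Setoid.ext fun a b => ⟨fun hab => ?_, fun hab => ?_⟩)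
  · exact (Quotient.mk_surjective (s := r)).bijective_of_nat_card_le h |>.1 (Quotient.sound hab)
  · obtain rfl : a = b := hab
    exact r.refl a

open Classical in
/-- The number of `s`-simplicial colorings, sorted by the partition into color classes. -/
theorem natCard_isSColoring {V : Type*} [DecidableEq V] [Finite V] [Fintype (Setoid V)]
    (Γ : Finset (Finset V)) (s t : ℕ) :
    Nat.card {f : V → Fin t // IsSColoring Γ s f} =
      ∑ r : Setoid V with IsSColoring Γ s (Quotient.mk r),
        t.descFactorial (Nat.card (Quotient r)) := by
  have := Fintype.ofFinite V
  rw [Nat.card_eq_fintype_card, Fintype.card_subtype,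
    Finset.card_eq_sum_card_fiberwise (f := Setoid.ker)
      (t := {r : Setoid V | IsSColoring Γ s (Quotient.mk r)})]
  · refine Finset.sum_congr rfl fun r hr => ?_
    rw [← natCard_ker_eq, Nat.card_eq_fintype_card, Fintype.card_subtype, Finset.filter_filter]
    congr 1
    ext f
    simp only [Finset.mem_filter, Finset.mem_univ, true_and, and_iff_right_iff_imp]
    intro hf
    exact (isSColoring_iff_of_ker_eq Γ s f hf).2 (Finset.mem_filter.1 hr).2
  · intro f hf
    have hf' := (Finset.mem_filter.1 (Finset.mem_coe.1 hf)).2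
    simpa using (isSColoring_iff_of_ker_eq Γ s f rfl).1 hf'

/-- The `s`-chromatic function `χ_s(Γ;t)` is a polynomial in `t` of degree `n`. -/
theorem stmt3 {V : Type*} [Fintype V] [Nonempty V] [DecidableEq V]
    (Γ : Finset (Finset V)) (hΓ : IsSimplicialComplex Γ) (s : ℕ) (hs : 1 ≤ s) :
    ∃ p : Polynomial ℚ, p.natDegree = Fintype.card V ∧
      ∀ t : ℕ, 0 < t → p.eval (t : ℚ) =
        Nat.card {f : V → Fin t // IsSColoring Γ s f} := by
  classical
  have : Finite (Setoid V) := Finite.of_injective (fun r : Setoid V => r.r)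
    fun r₁ r₂ h => Setoid.ext fun a b => iff_of_eq (congrFun₂ h a b)
  have := Fintype.ofFinite (Setoid V)
  refine ⟨∑ r : Setoid V with IsSColoring Γ s (Quotient.mk r),
    descPochhammer ℚ (Nat.card (Quotient r)), ?_, fun t _ => ?_⟩
  · have hbot : Function.Bijective (Quotient.mk (⊥ : Setoid V)) :=
      ⟨fun a b h => Quotient.exact h, Quotient.mk_surjective⟩
    have hcard : Nat.card (Quotient (⊥ : Setoid V)) = Fintype.card V := by
      rw [← Nat.card_eq_of_bijective _ hbot, Nat.card_eq_fintype_card]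
    have hmem : (⊥ : Setoid V) ∈
        ({r : Setoid V | IsSColoring Γ s (Quotient.mk r)} : Finset (Setoid V)) := by
      exact Finset.mem_filter.2 ⟨Finset.mem_univ _, isSColoring_of_injective Γ hs hbot.1⟩
    rw [← Finset.add_sum_erase _ _ hmem, hcard, Polynomial.natDegree_add_eq_left_of_degree_lt,
      descPochhammer_natDegree]
    rw [Polynomial.degree_eq_natDegree (monic_descPochhammer ℚ _).ne_zero,
      descPochhammer_natDegree, ← Polynomial.mem_degreeLT]
    refine Submodule.sum_mem _ fun r hr => ?_
    rw [Polynomial.mem_degreeLT,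
      Polynomial.degree_eq_natDegree (monic_descPochhammer ℚ _).ne_zero,
      descPochhammer_natDegree, ← Nat.card_eq_fintype_card]
    exact_mod_cast natCard_quotient_lt (Finset.ne_of_mem_erase hr)
  · rw [natCard_isSColoring, Polynomial.eval_finsetSum, Nat.cast_sum]
    exact Finset.sum_congr rfl fun r _ => descPochhammer_eval_eq_descFactorial ℚ t _
end

section
/- For every integer n ≥ 1, the following identity holds in ℤ[q]: Σ_{ω ∈ S_n} (q+1)^{des(ω)} = Σ_{α ⊨ n} (n choose α) · q^{n − ℓ(α)}, i.e. A_n(q+1) = Σ_{α ⊨ n} (n choose α) q^{n−ℓ(α)}, where the right sum runs over all compositions α of n. -/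
open Finset Polynomial

open scoped Classical in
/-- The number of descents of a permutation `ω` of `{0, …, n-1}`:
positions `i` with `ω i > ω (i+1)`. -/
noncomputable def numDescents {n : ℕ} (ω : Equiv.Perm (Fin n)) : ℕ :=
  (Finset.univ.filter (fun i : Fin n =>
    ∃ h : (i : ℕ) + 1 < n, ω ⟨(i : ℕ) + 1, h⟩ < ω i)).card

/-- The multinomial coefficient `(n choose α) = n! / (α₁! ⋯ α_l!)` of a composition `α` of
`n`. -/
def compMultinomial {n : ℕ} (α : Composition n) : ℕ :=
  n.factorial / (α.blocks.map Nat.factorial).prod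

namespace BlockDescents

/-- The descents of a permutation of `{0, …, m}`, as a subset of `{0, …, m-1}`. -/
def descents {m : ℕ} (ω : Equiv.Perm (Fin (m + 1))) : Finset (Fin m) :=
  {j | ω j.succ < ω j.castSucc}

/-- The positions `j` of `{0, …, m-1}` such that `j` and `j + 1` lie in the same block of `α`. -/
def innerPositions {m : ℕ} (α : Composition (m + 1)) : Finset (Fin m) :=
  {j | j.succ.castSucc ∉ α.boundaries}

theorem numDescents_eq_card_descents {m : ℕ} (ω : Equiv.Perm (Fin (m + 1))) :
    numDescents ω = #(descents ω) := by
  classical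
  rw [numDescents, ← card_map (s := descents ω) Fin.castSuccEmb]
  refine congrArg card ?_
  ext i
  simp only [mem_filter, mem_univ, true_and, mem_map, descents, Fin.coe_castSuccEmb]
  constructor
  · rintro ⟨h, hi⟩
    exact ⟨⟨i, by lia⟩, hi, rfl⟩
  · rintro ⟨j, hj, rfl⟩
    exact ⟨by simp, hj⟩

theorem innerPositions_bijective (m : ℕ) :
    Function.Bijective (innerPositions : Composition (m + 1) → Finset (Fin m)) := by
  have h : (innerPositions : Composition (m + 1) → Finset (Fin m)) =
      compl ∘ compositionAsSetEquiv (m + 1) ∘ compositionEquiv (m + 1) := by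
    ext α j
    have hj : (⟨1 + (j : ℕ), by lia⟩ : Fin (m + 2)) = j.succ.castSucc :=
      Fin.ext (Nat.add_comm _ _)
    simp only [innerPositions, compositionAsSetEquiv, compositionEquiv, Function.comp_apply,
      Equiv.coe_fn_mk, Composition.toCompositionAsSet_boundaries, mem_compl, mem_filter,
      mem_univ, true_and]
    refine not_congr (Iff.trans ?_ Set.mem_toFinset.symm)
    exact hj ▸ Iff.rfl
  rw [h]
  exact compl_bijective.comp ((Equiv.bijective _).comp (Equiv.bijective _))

theorem card_innerPositions {m : ℕ} (α : Composition (m + 1)) :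
    #(innerPositions α) = m + 1 - α.length := by
  have h : (innerPositions α).map (Fin.succEmb m |>.trans Fin.castSuccEmb) = α.boundariesᶜ := by
    ext i
    simp only [mem_map, innerPositions, mem_filter, mem_univ, true_and, mem_compl]
    constructor
    · rintro ⟨j, hj, rfl⟩
      exact hj
    · intro hi
      have h0 : i ≠ 0 := by
        rintro rfl
        exact hi α.toCompositionAsSet.zero_mem
      have hl : i ≠ Fin.last _ := by
        rintro rfl
        exact hi α.toCompositionAsSet.getLast_mem
      obtain ⟨k, rfl⟩ := Fin.exists_castSucc_eq.2 hl
      obtain ⟨j, rfl⟩ := Fin.exists_succ_eq.2 (fun hk : k = 0 => h0 (by simp [hk]))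
      exact ⟨j, hi, rfl⟩
  rw [← card_map, h, card_compl, α.card_boundaries_eq_succ_length, Fintype.card_fin]
  lia

theorem mem_boundaries_iff {n : ℕ} (α : Composition n) (i : Fin (n + 1)) :
    i ∈ α.boundaries ↔ ∃ k ≤ α.length, α.sizeUpTo k = i := by
  simp [Composition.boundaries, Composition.boundary, Fin.exists_iff, Fin.ext_iff]

theorem strictAnti_of_succ_lt {β : Type*} [Preorder β] {b : ℕ} {f : Fin b → β}
    (h : ∀ (k : ℕ) (hk : k + 1 < b), f ⟨k + 1, hk⟩ < f ⟨k, by lia⟩) : StrictAnti f := by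
  cases b with
  | zero => exact fun a => a.elim0
  | succ b => exact Fin.strictAnti_iff_succ_lt.2 fun k => h k (by lia)

/-- A permutation has descents at all inner positions of a composition exactly when it is
decreasing on each block. -/
theorem innerPositions_subset_descents_iff {m : ℕ} (α : Composition (m + 1))
    (ω : Equiv.Perm (Fin (m + 1))) :
    innerPositions α ⊆ descents ω ↔ ∀ i, StrictAnti (ω ∘ α.embedding i) := by
  simp only [subset_iff, innerPositions, descents, mem_filter, mem_univ, true_and,
    mem_boundaries_iff, Fin.val_castSucc, Fin.val_succ]
  constructor
  · intro h i
    refine strictAnti_of_succ_lt fun k hk => ?_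
    have hs := α.sizeUpTo_succ' i
    have hle := α.sizeUpTo_le (i + 1)
    refine h (x := ⟨α.sizeUpTo i + k, by lia⟩) ?_
    rintro ⟨l, -, hl⟩
    rcases le_or_gt l i with h' | h'
    · have := α.monotone_sizeUpTo h'
      simp only at hl
      lia
    · have := α.monotone_sizeUpTo (Nat.succ_le_of_lt h')
      simp only [Nat.succ_eq_add_one] at hl this
      lia
  · intro h j hj
    have h1 := α.lt_sizeUpTo_index_succ j.castSucc
    have h2 := α.sizeUpTo_index_le j.castSucc
    set i := α.index j.castSucc
    have hs := α.sizeUpTo_succ' i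
    simp only [Fin.val_castSucc, Fin.val_succ] at h1 h2
    have h3 : α.sizeUpTo (i + 1) ≠ j + 1 := fun h => hj ⟨_, i.2, h⟩
    have := @h i ⟨j - α.sizeUpTo i, by lia⟩ ⟨j + 1 - α.sizeUpTo i, by lia⟩
      (by simp only [Fin.mk_lt_mk]; lia)
    convert! this using 2 <;> simp [Fin.ext_iff] <;> lia

/-- Rearranging a family of decreasing blocks inside each block yields every bijection exactly
once. -/
theorem card_strictAnti_blocks_mul {l n : ℕ} (b : Fin l → ℕ) (hb : ∑ i, b i = n)
    [DecidablePred fun f : (Σ i, Fin (b i)) ≃ Fin n => ∀ i, StrictAnti fun j => f ⟨i, j⟩] :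
    Fintype.card {f : (Σ i, Fin (b i)) ≃ Fin n // ∀ i, StrictAnti fun j => f ⟨i, j⟩} *
      ∏ i, (b i).factorial = n.factorial := by
  have hperm : ∏ i, (b i).factorial = Fintype.card (∀ i, Equiv.Perm (Fin (b i))) := by
    simp [Fintype.card_perm]
  have hall : n.factorial = Fintype.card ((Σ i, Fin (b i)) ≃ Fin n) := by
    rw [Fintype.card_equiv (Fintype.equivOfCardEq (by simp [hb]))]
    simp [hb]
  rw [hperm, hall, ← Fintype.card_prod]
  refine Fintype.card_of_bijective
    (f := fun p => (Equiv.sigmaCongrRight p.2).trans p.1.1) ⟨?_, ?_⟩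
  · rintro ⟨⟨f, hf⟩, σ⟩ ⟨⟨g, hg⟩, τ⟩ h
    have h' : ∀ i j, f ⟨i, σ i j⟩ = g ⟨i, τ i j⟩ := fun i j =>
      DFunLike.congr_fun h (⟨i, j⟩ : Σ i, Fin (b i))
    have hfg : f = g := by
      ext ⟨i, j⟩ : 1
      refine congrFun ((StrictAnti.range_inj (hf i) (hg i)).1 ?_) j
      rw [← (σ i).surjective.range_comp, ← (τ i).surjective.range_comp (fun j => g ⟨i, j⟩)]
      exact congrArg Set.range (funext (h' i))
    subst hfg
    have : σ = τ := by
      ext i j : 2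
      simpa using h' i j
    rw [this]
  · intro g
    let s : ∀ i, Equiv.Perm (Fin (b i)) := fun i =>
      Tuple.sort fun j => OrderDual.toDual (g ⟨i, j⟩)
    refine ⟨⟨⟨(Equiv.sigmaCongrRight s).trans g, fun i => ?_⟩, fun i => (s i).symm⟩, ?_⟩
    · refine Antitone.strictAnti_of_injective
        (fun x y hxy => Tuple.monotone_sort (fun j => OrderDual.toDual (g ⟨i, j⟩)) hxy) ?_
      intro x y hxy
      simpa using hxy
    · ext ⟨i, j⟩
      simp

theorem card_innerPositions_subset_descents {m : ℕ} (α : Composition (m + 1)) :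
    #{ω : Equiv.Perm (Fin (m + 1)) | innerPositions α ⊆ descents ω} = compMultinomial α := by
  classical
  have hprod : (α.blocks.map Nat.factorial).prod = ∏ i, (α.blocksFun i).factorial := by
    rw [← α.ofFn_blocksFun, List.map_ofFn, List.prod_ofFn]
    rfl
  rw [compMultinomial, hprod, ← card_strictAnti_blocks_mul α.blocksFun α.sum_blocksFun,
    Nat.mul_div_cancel _ (prod_pos fun i _ => Nat.factorial_pos _), ← Fintype.card_subtype]
  refine Fintype.card_congr ((α.blocksFinEquiv.symm.equivCongr (Equiv.refl _)).subtypeEquiv ?_)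
  exact innerPositions_subset_descents_iff α

end BlockDescents

/-- `A_n(q+1) = Σ_{α ⊨ n} (n choose α) q^{n-ℓ(α)}` in `ℤ[q]`. -/
theorem stmt6 (n : ℕ) (hn : 1 ≤ n) :
    ∑ ω : Equiv.Perm (Fin n), ((X : ℤ[X]) + 1) ^ numDescents ω =
      ∑ α : Composition n, (compMultinomial α : ℤ[X]) * X ^ (n - α.length) := by
  classical
  obtain ⟨m, rfl⟩ : ∃ m, n = m + 1 := ⟨n - 1, by lia⟩
  have hpow (ω : Equiv.Perm (Fin (m + 1))) : ((X : ℤ[X]) + 1) ^ numDescents ω =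
      ∑ S : Finset (Fin m), if S ⊆ BlockDescents.descents ω then X ^ #S else 0 := by
    rw [BlockDescents.numDescents_eq_card_descents, ← sum_filter, filter_subset_univ,
      ← sum_pow_mul_eq_add_pow]
    simp
  simp_rw [hpow]
  rw [sum_comm, ← (BlockDescents.innerPositions_bijective m).sum_comp]
  refine sum_congr rfl fun α _ => ?_
  rw [← sum_filter, sum_const, BlockDescents.card_innerPositions_subset_descents,
    BlockDescents.card_innerPositions, nsmul_eq_mul]
end

section
/- For every integer n ≥ 1, the following identity holds in ℤ[q]: −n·(q−2)^{n−1} = Σ_{α ⊨ n} (−1)^{ℓ(α)} (n choose α) · ( Σ_{i=1}^{ℓ(α)} α_i q^{α_i − 1} ), where the sum runs over all compositions α of n. -/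
open Finset Polynomial

/-- The multinomial coefficient of a list of naturals, as a product of binomial coefficients. -/
def listMultinomial : List ℕ → ℕ
  | [] => 1
  | a :: l => (a + l.sum).choose a * listMultinomial l

theorem listMultinomial_mul_prod_factorial (l : List ℕ) :
    listMultinomial l * (l.map Nat.factorial).prod = l.sum.factorial := by
  induction l with
  | nil => simp [listMultinomial]
  | cons a l ih =>
    rw [listMultinomial, List.map_cons, List.prod_cons, List.sum_cons,
      ← Nat.add_choose_mul_factorial_mul_factorial a l.sum, ← ih, Nat.choose_symm_add]
    ring

theorem compMultinomial_eq_listMultinomial {n : ℕ} (α : Composition n) :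
    compMultinomial α = listMultinomial α.blocks := by
  have h := listMultinomial_mul_prod_factorial α.blocks
  rw [α.blocks_sum] at h
  have hpos : 0 < (α.blocks.map Nat.factorial).prod :=
    Nat.pos_of_ne_zero fun h0 => n.factorial_ne_zero (by rw [← h, h0, mul_zero])
  exact Nat.div_eq_of_eq_mul_left hpos h.symm

/-- A sum over the compositions of `n + 1`, split according to the first block. -/
theorem Composition.sum_blocks_succ {M : Type*} [AddCommMonoid M] (f : List ℕ → M) (n : ℕ) :
    ∑ α : Composition (n + 1), f α.blocks =
      ∑ k : Fin (n + 1), ∑ β : Composition (n - k), f ((k + 1 : ℕ) :: β.blocks) := by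
  rw [← Fintype.sum_sigma'
    (fun (k : Fin (n + 1)) (β : Composition (n - k)) => f ((k + 1 : ℕ) :: β.blocks))]
  symm
  refine Fintype.sum_bijective
    (fun x : (k : Fin (n + 1)) × Composition (n - k) =>
      (⟨(x.1 + 1 : ℕ) :: x.2.blocks, fun {i} hi => by
          rcases List.mem_cons.1 hi with rfl | hi
          · exact Nat.succ_pos _
          · exact x.2.blocks_pos hi, by
          rw [List.sum_cons, x.2.blocks_sum]
          have := x.1.isLt
          omega⟩ : Composition (n + 1))) ⟨?_, ?_⟩ _ _ fun _ => rfl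
  · rintro ⟨k, β⟩ ⟨k', β'⟩ h
    obtain ⟨hk, hβ⟩ := List.cons.inj (congrArg Composition.blocks h)
    obtain rfl : k = k' := Fin.ext (Nat.succ.inj hk)
    exact Sigma.ext rfl (heq_of_eq (Composition.ext hβ))
  · rintro ⟨_ | ⟨a, l⟩, hpos, hsum⟩
    · simp at hsum
    · have ha : 0 < a := hpos (by simp)
      rw [List.sum_cons] at hsum
      refine ⟨⟨⟨a - 1, by omega⟩, ⟨l, fun {i} hi => hpos (List.mem_cons_of_mem _ hi), ?_⟩⟩, ?_⟩
      · simp only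
        omega
      · ext1
        simp only [List.cons.injEq, and_true]
        omega

theorem Composition.sum_blocks_zero {M : Type*} [AddCommMonoid M] (f : List ℕ → M) :
    ∑ α : Composition 0, f α.blocks = f [] := by
  have hnil (α : Composition 0) : α.blocks = [] := α.blocks_eq_nil.2 rfl
  simp only [hnil, sum_const, card_univ, composition_card, zero_tsub, pow_zero, one_smul]

/-- The multinomial coefficient of `l` with the sign `(-1)^{ℓ(l)}`. -/
noncomputable def signedMultinomial (l : List ℕ) : ℤ[X] :=
  (-1) ^ l.length * (listMultinomial l : ℤ[X])

theorem signedMultinomial_cons_blocks {n : ℕ} (k : Fin (n + 1)) (β : Composition (n - k)) :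
    signedMultinomial ((k + 1 : ℕ) :: β.blocks) =
      -((n + 1).choose (k + 1) * signedMultinomial β.blocks) := by
  have hk : (k + 1 : ℕ) + (n - k) = n + 1 := by have := k.isLt; omega
  simp only [signedMultinomial, listMultinomial, β.blocks_sum, hk, List.length_cons, pow_succ,
    Nat.cast_mul]
  ring

theorem sum_signedMultinomial (n : ℕ) :
    ∑ α : Composition n, signedMultinomial α.blocks = (-1) ^ n := by
  induction n using Nat.strong_induction_on with
  | _ n ih =>
    rcases n with _ | n
    · rw [Composition.sum_blocks_zero]
      simp [signedMultinomial, listMultinomial]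
    · rw [Composition.sum_blocks_succ]
      simp only [signedMultinomial_cons_blocks, sum_neg_distrib, ← mul_sum]
      have h := add_pow (1 : ℤ[X]) (-1) (n + 1)
      rw [add_neg_cancel, zero_pow n.succ_ne_zero, sum_range_succ'] at h
      rw [sum_congr rfl fun k _ => by rw [ih (n - k) (by omega)],
        Fin.sum_univ_eq_sum_range (fun k => ((n + 1).choose (k + 1) : ℤ[X]) * (-1) ^ (n - k))]
      simp only [one_pow, one_mul, Nat.add_sub_add_right, Nat.choose_zero_right, Nat.cast_one,
        mul_one, Nat.sub_zero] at h
      simp only [mul_comm ((Nat.choose _ _ : ℕ) : ℤ[X])]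
      linear_combination h

theorem sum_signedMultinomial_mul_sum_derivative (n : ℕ) :
    ∑ α : Composition n, signedMultinomial α.blocks *
      (α.blocks.map fun a : ℕ => derivative ((X : ℤ[X]) ^ a)).sum =
      -derivative (((X : ℤ[X]) - 2) ^ n) := by
  induction n using Nat.strong_induction_on with
  | _ n ih =>
    rcases n with _ | n
    · rw [Composition.sum_blocks_zero fun l => signedMultinomial l *
        (l.map fun a : ℕ => derivative ((X : ℤ[X]) ^ a)).sum]
      simp
    · rw [Composition.sum_blocks_succ fun l => signedMultinomial l *
        (l.map fun a : ℕ => derivative ((X : ℤ[X]) ^ a)).sum]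
      have step (k : Fin (n + 1)) : ∑ β : Composition (n - k),
          signedMultinomial ((k + 1 : ℕ) :: β.blocks) *
            (((k + 1 : ℕ) :: β.blocks).map fun a : ℕ => derivative ((X : ℤ[X]) ^ a)).sum =
          derivative (((X : ℤ[X]) - 2) ^ (n - k) * ((n + 1).choose (k + 1) : ℤ[X]) -
            (X : ℤ[X]) ^ (k + 1 : ℕ) * (-1) ^ (n - k) * ((n + 1).choose (k + 1) : ℤ[X])) := by
        have hconst : derivative ((-1 : ℤ[X]) ^ (n - k : ℕ)) = 0 := by
          simp [derivative_pow]
        simp only [signedMultinomial_cons_blocks, List.map_cons, List.sum_cons, mul_add, neg_mul,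
          mul_assoc, sum_add_distrib, sum_neg_distrib, ← mul_sum, ← sum_mul,
          sum_signedMultinomial, ih (n - k) (by omega)]
        rw [derivative_sub, derivative_mul, derivative_mul, derivative_mul, hconst,
          derivative_natCast]
        ring
      have h₁ := add_pow (1 : ℤ[X]) (X - 2) (n + 1)
      have h₂ := add_pow (X : ℤ[X]) (-1) (n + 1)
      rw [sum_range_succ'] at h₁ h₂
      simp only [one_pow, one_mul, Nat.add_sub_add_right, Nat.choose_zero_right, Nat.cast_one,
        mul_one, Nat.sub_zero, pow_zero] at h₁ h₂
      have hX : 1 + ((X : ℤ[X]) - 2) = X + -1 := by ring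
      rw [hX] at h₁
      have hconst : derivative ((-1 : ℤ[X]) ^ (n + 1)) = 0 := by simp [derivative_pow]
      rw [sum_congr rfl fun k _ => step k, Fin.sum_univ_eq_sum_range (fun k : ℕ =>
          derivative (((X : ℤ[X]) - 2) ^ (n - k) * ((n + 1).choose (k + 1) : ℤ[X]) -
            (X : ℤ[X]) ^ (k + 1) * (-1) ^ (n - k) * ((n + 1).choose (k + 1) : ℤ[X]))),
        ← derivative_sum, sum_sub_distrib, ← sub_eq_zero, sub_neg_eq_add, ← derivative_add,
        ← hconst]
      congr 1
      linear_combination h₂ - h₁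

/-- `-n (q-2)^{n-1} = Σ_{α ⊨ n} (-1)^{ℓ(α)} (n choose α) Σ_i α_i q^{α_i - 1}` in `ℤ[q]`. -/
theorem stmt9 (n : ℕ) (hn : 1 ≤ n) :
    -(n : ℤ[X]) * ((X : ℤ[X]) - 2) ^ (n - 1) =
      ∑ α : Composition n, (-1 : ℤ[X]) ^ α.length * (compMultinomial α : ℤ[X]) *
        (α.blocks.map (fun a : ℕ => (a : ℤ[X]) * (X : ℤ[X]) ^ (a - 1))).sum := by
  have h := sum_signedMultinomial_mul_sum_derivative n
  simp only [derivative_X_pow, map_natCast, signedMultinomial] at h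
  simp only [compMultinomial_eq_listMultinomial, Composition.length]
  rw [h]
  simp [derivative_pow]
end

section
/- For all positive integers n and k: (−1)^{n−1} · Σ_{j=1}^{k} (−1)^j · Surj(k,j) · C(n,j) = Σ_{α ⊨ n} (−1)^{ℓ(α)} (n choose α) · α^k, where Surj(k,j) is the number of surjective functions from a k-element set onto a j-element set, C(n,j) is the binomial coefficient, the right sum runs over all compositions α of n, and α^k = Σ_{i=1}^{ℓ(α)} α_i^k. (Since Surj(k,j) = j!·S(k,j) with S(k,j) the Stirling number of the second kind and C(n,j)·j! = (n)_j the falling factorial, the left side equals (−1)^{n−1} Σ_{j=1}^k (−1)^j S(k,j)(n)_j.) -/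
open Finset

/-- `Surj(k,j)`: the number of surjections from a `k`-element set onto a `j`-element set. -/
noncomputable def numSurj (k j : ℕ) : ℕ :=
  Nat.card {f : Fin k → Fin j // Function.Surjective f}

lemma sum_composition_succ {M : Type*} [AddCommMonoid M] (n : ℕ) (f : List ℕ → M) :
    ∑ c : Composition (n + 1), f c.blocks =
      ∑ i : Fin (n + 1), ∑ c : Composition (n - i), f ((i + 1) :: c.blocks) := by
  rw [← Fintype.sum_sigma fun x : (i : Fin (n + 1)) × Composition (n - i) =>
    f ((x.1 + 1) :: x.2.blocks)]
  symm
  refine Fintype.sum_bijective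
    (fun x : (i : Fin (n + 1)) × Composition (n - i) =>
      (⟨(x.1 + 1) :: x.2.blocks, ?_, ?_⟩ : Composition (n + 1))) ⟨?_, ?_⟩ _ _ fun _ => rfl
  · intro i hi
    rcases List.mem_cons.1 hi with rfl | h
    · omega
    · exact x.2.blocks_pos h
  · have := x.1.2
    simp only [List.sum_cons, x.2.blocks_sum]
    omega
  · rintro ⟨i, c⟩ ⟨j, d⟩ h
    simp only [Composition.mk.injEq, List.cons.injEq, add_left_inj] at h
    obtain rfl := Fin.ext h.1
    rw [Composition.ext h.2]
  · rintro ⟨l, hpos, hsum⟩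
    cases l with
    | nil => simp at hsum
    | cons a l =>
      have ha := hpos (i := a) (by simp)
      simp only [List.sum_cons] at hsum
      refine ⟨⟨⟨a - 1, by omega⟩, ⟨l, fun h => hpos (by simp [h]), by simp only; omega⟩⟩, ?_⟩
      ext1
      simp only [List.cons.injEq, and_true]
      omega

lemma prod_factorial_mul_multinomial (l : List ℕ) :
    (l.map Nat.factorial).prod * l.multinomial = l.sum.factorial := by
  induction l with
  | nil => simp [List.multinomial, Finsupp.multinomial]
  | cons a l ih =>
    rw [List.multinomial_cons, List.map_cons, List.prod_cons, List.sum_cons,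
      ← Nat.add_choose_mul_factorial_mul_factorial, Nat.choose_symm_add, ← ih]
    ring

lemma compMultinomial_eq {n : ℕ} (α : Composition n) :
    compMultinomial α = α.blocks.multinomial := by
  have h := prod_factorial_mul_multinomial α.blocks
  rw [α.blocks_sum] at h
  rw [compMultinomial, ← h]
  refine Nat.mul_div_cancel_left _ (List.prod_pos fun a ha => ?_)
  obtain ⟨b, -, rfl⟩ := List.mem_map.1 ha
  exact b.factorial_pos

lemma card_range_eq (k a : ℕ) (s : Finset (Fin a)) :
    #{f : Fin k → Fin a | univ.image f = s} = numSurj k #s := by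
  rw [numSurj, ← Fintype.card_subtype, ← Nat.card_eq_fintype_card]
  let e : {f : Fin k → Fin a // univ.image f = s} ≃
      {g : Fin k → s // Function.Surjective g} :=
    { toFun := fun f => ⟨fun i => ⟨f.1 i, f.2.subset (mem_image_of_mem _ (mem_univ i))⟩,
        fun y => by
          obtain ⟨i, -, hi⟩ := Finset.mem_image.1 (f.2.symm.subset y.2)
          exact ⟨i, Subtype.ext hi⟩⟩
      invFun := fun g => ⟨fun i => g.1 i, by
        ext x
        simp only [mem_image, mem_univ, true_and]
        constructor
        · rintro ⟨i, rfl⟩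
          exact (g.1 i).2
        · intro hx
          obtain ⟨i, hi⟩ := g.2 ⟨x, hx⟩
          exact ⟨i, by rw [hi]⟩⟩
      left_inv := fun _ => rfl
      right_inv := fun _ => rfl }
  refine Nat.card_congr (e.trans (Equiv.subtypeEquiv
    (Equiv.arrowCongr (Equiv.refl (Fin k)) s.equivFin) fun f => ?_))
  simp [Equiv.arrowCongr]

lemma pow_eq_sum_numSurj (k a : ℕ) :
    a ^ k = ∑ j ∈ range (a + 1), numSurj k j * a.choose j := by
  have h := Finset.card_eq_sum_card_fiberwise (s := (univ : Finset (Fin k → Fin a)))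
    (t := (univ : Finset (Fin a)).powerset) (f := fun f => univ.image f) (by intro; simp)
  simp only [card_range_eq] at h
  rw [Finset.sum_powerset_apply_card] at h
  simpa [mul_comm] using h

lemma numSurj_eq_zero_of_lt {k j : ℕ} (h : k < j) : numSurj k j = 0 := by
  have : IsEmpty {f : Fin k → Fin j // Function.Surjective f} :=
    ⟨fun f => h.not_ge (by simpa using Fintype.card_le_of_surjective f.1 f.2)⟩
  exact Nat.card_of_isEmpty

lemma sum_choose_mul_choose_alternating (n j : ℕ) :
    ∑ m ∈ range (n + 1), (-1 : ℤ) ^ m * n.choose m * m.choose j =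
      if n = j then (-1) ^ j else 0 := by
  rcases lt_or_ge n j with h | h
  · rw [if_neg (by omega)]
    refine Finset.sum_eq_zero fun m hm => ?_
    rw [Nat.choose_eq_zero_of_lt (n := m) (by have := mem_range.1 hm; omega)]
    simp
  · obtain ⟨d, rfl⟩ := Nat.exists_eq_add_of_le h
    rw [add_assoc, Finset.sum_range_add, Finset.sum_eq_zero, zero_add]
    · have : ∀ i ∈ range (d + 1), (-1 : ℤ) ^ (j + i) * (j + d).choose (j + i) * (j + i).choose j =
          (-1) ^ j * (j + d).choose j * ((-1) ^ i * d.choose i) := by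
        intro i hi
        have := Nat.choose_mul (n := j + d) (k := j + i) (s := j)
          (by omega)
        simp only [Nat.add_sub_cancel_left] at this
        rw [mul_assoc, ← Nat.cast_mul, this, pow_add]
        push_cast
        ring
      rw [Finset.sum_congr rfl this, ← Finset.mul_sum, Int.alternating_sum_range_choose]
      rcases eq_or_ne d 0 with rfl | hd
      · simp
      · simp [hd]
    · intro m hm
      rw [Nat.choose_eq_zero_of_lt (mem_range.1 hm)]
      simp

lemma numSurj_eq_alternating_sum (n k : ℕ) :
    ∑ m ∈ range (n + 1), (-1 : ℤ) ^ m * n.choose m * m ^ k = (-1) ^ n * numSurj k n := by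
  have h : ∀ m ∈ range (n + 1), (-1 : ℤ) ^ m * n.choose m * m ^ k =
      ∑ j ∈ range (n + 1), numSurj k j * ((-1 : ℤ) ^ m * n.choose m * m.choose j) := by
    intro m hm
    have hp : (m : ℤ) ^ k = ∑ j ∈ range (n + 1), (numSurj k j : ℤ) * m.choose j := by
      rw [← Nat.cast_pow, pow_eq_sum_numSurj]
      push_cast
      refine Finset.sum_subset (by intro x; simp at hm ⊢; omega) fun j _ hj => ?_
      rw [Nat.choose_eq_zero_of_lt (by simp at hj; omega)]
      simp
    rw [hp, Finset.mul_sum]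
    exact Finset.sum_congr rfl fun j _ => by ring
  rw [Finset.sum_congr rfl h, Finset.sum_comm]
  simp only [← Finset.mul_sum, sum_choose_mul_choose_alternating]
  simp [mul_comm]

lemma sum_choose_mul_signed_sum (n k : ℕ) (hn : 1 ≤ n) :
    ∑ m ∈ range (n + 1), (n.choose m : ℤ) *
        ((-1) ^ m * ∑ j ∈ Icc 1 k, (-1 : ℤ) ^ j * numSurj k j * m.choose j) = numSurj k n := by
  have h : ∀ m ∈ range (n + 1), (n.choose m : ℤ) *
        ((-1) ^ m * ∑ j ∈ Icc 1 k, (-1 : ℤ) ^ j * numSurj k j * m.choose j) =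
      ∑ j ∈ Icc 1 k, (-1 : ℤ) ^ j * numSurj k j * ((-1) ^ m * n.choose m * m.choose j) := by
    intro m _
    rw [Finset.mul_sum, Finset.mul_sum]
    exact Finset.sum_congr rfl fun j _ => by ring
  rw [Finset.sum_congr rfl h, Finset.sum_comm]
  simp only [← Finset.mul_sum, sum_choose_mul_choose_alternating, mul_ite, mul_zero]
  rw [Finset.sum_ite_eq]
  split_ifs with hnk
  · rw [mul_right_comm, ← mul_pow]
    simp
  · rw [numSurj_eq_zero_of_lt (by simp only [mem_Icc] at hnk; omega)]
    simp

lemma signed_multinomial_cons {n : ℕ} (i : Fin (n + 1)) (c : Composition (n - i)) :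
    (-1 : ℤ) ^ ((i + 1 : ℕ) :: c.blocks).length * ((i + 1 : ℕ) :: c.blocks).multinomial =
      -((n + 1).choose (i + 1) * ((-1) ^ c.blocks.length * c.blocks.multinomial)) := by
  have : (i : ℕ) + 1 + (n - i) = n + 1 := by omega
  rw [List.multinomial_cons, c.blocks_sum, this, List.length_cons, pow_succ]
  push_cast
  ring

lemma neg_one_pow_sub {n i : ℕ} (h : i ≤ n) : (-1 : ℤ) ^ (n - i) = (-1) ^ n * (-1) ^ i := by
  obtain ⟨d, rfl⟩ := Nat.exists_eq_add_of_le h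
  rw [Nat.add_sub_cancel_left, pow_add, mul_right_comm, ← mul_pow]
  simp

lemma sum_signed_multinomial (n : ℕ) :
    ∑ c : Composition n, (-1 : ℤ) ^ c.blocks.length * c.blocks.multinomial = (-1) ^ n := by
  induction n using Nat.strong_induction_on with
  | _ n ih =>
    cases n with
    | zero =>
      have h : ∀ c : Composition 0, c.blocks = [] := fun c => c.blocks_eq_nil.2 rfl
      simp [h, List.multinomial, Finsupp.multinomial, composition_card]
    | succ n =>
      rw [sum_composition_succ n fun l => (-1 : ℤ) ^ l.length * l.multinomial]
      simp only [signed_multinomial_cons, Finset.sum_neg_distrib, ← Finset.mul_sum]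
      rw [Finset.sum_congr rfl fun i _ => by rw [ih (n - i) (by omega)],
        Fin.sum_univ_eq_sum_range fun i => ((n + 1).choose (i + 1) : ℤ) * (-1) ^ (n - i)]
      have h := Int.alternating_sum_range_choose_of_ne (n := n + 1) (by omega)
      rw [Finset.sum_range_succ'] at h
      rw [pow_succ, ← Finset.sum_neg_distrib]
      have hs : ∀ i ∈ range (n + 1), -(((n + 1).choose (i + 1) : ℤ) * (-1) ^ (n - i)) =
          (-1) ^ n * ((-1) ^ (i + 1) * (n + 1).choose (i + 1)) := by
        intro i hi
        rw [neg_one_pow_sub (by simp at hi; omega)]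
        ring
      rw [Finset.sum_congr rfl hs, ← Finset.mul_sum, eq_neg_of_add_eq_zero_left h]
      simp

lemma sum_signed_multinomial_mul_sum_pow (n k : ℕ) (hk : 1 ≤ k) :
    ∑ c : Composition n, (-1 : ℤ) ^ c.blocks.length * c.blocks.multinomial *
        ((c.blocks.map (fun a : ℕ => a ^ k)).sum : ℕ) =
      -((-1) ^ n * ∑ j ∈ Icc 1 k, (-1 : ℤ) ^ j * numSurj k j * n.choose j) := by
  induction n using Nat.strong_induction_on with
  | _ n ih =>
    cases n with
    | zero =>
      have h : ∀ c : Composition 0, c.blocks = [] := fun c => c.blocks_eq_nil.2 rfl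
      simp only [h, List.map_nil, List.sum_nil, Nat.cast_zero, mul_zero, Finset.sum_const_zero]
      rw [Finset.sum_eq_zero, mul_zero, neg_zero]
      intro j hj
      rw [Nat.choose_eq_zero_of_lt (by simp at hj; omega)]
      simp
    | succ n =>
      set L : ℕ → ℤ := fun m =>
        (-1) ^ m * ∑ j ∈ Icc 1 k, (-1 : ℤ) ^ j * numSurj k j * m.choose j with hL
      have hsurj : ∑ m ∈ range (n + 1 + 1), ((n + 1).choose m : ℤ) * L (n + 1 - m) =
          numSurj k (n + 1) := by
        rw [← sum_choose_mul_signed_sum (n + 1) k (by omega), ← Finset.sum_range_reflect]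
        refine Finset.sum_congr rfl fun m hm => ?_
        have hm' : m ≤ n + 1 := by simp at hm; omega
        rw [show n + 1 + 1 - 1 - m = n + 1 - m by omega, Nat.choose_symm hm',
          Nat.sub_sub_self hm']
      have hpow := numSurj_eq_alternating_sum (n + 1) k
      rw [Finset.sum_range_succ'] at hsurj hpow
      simp only [Nat.cast_zero, zero_pow (by omega : k ≠ 0), mul_zero, add_zero,
        Nat.choose_zero_right, Nat.cast_one, one_mul, Nat.sub_zero, Nat.add_sub_add_right]
        at hsurj hpow
      have hstep : ∀ i : Fin (n + 1), ∑ c : Composition (n - i),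
          (-1 : ℤ) ^ ((i + 1 : ℕ) :: c.blocks).length * ((i + 1 : ℕ) :: c.blocks).multinomial *
            ((((i + 1 : ℕ) :: c.blocks).map (fun a : ℕ => a ^ k)).sum : ℕ) =
          (-1) ^ (n + 1) * ((-1) ^ (i + 1 : ℕ) * (n + 1).choose (i + 1) * ((i + 1 : ℕ) : ℤ) ^ k) *
              -1 +
            (n + 1).choose (i + 1) * L (n - i) := by
        intro i
        have hc : ∀ c : Composition (n - i),
            (-1 : ℤ) ^ ((i + 1 : ℕ) :: c.blocks).length * ((i + 1 : ℕ) :: c.blocks).multinomial *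
              ((((i + 1 : ℕ) :: c.blocks).map (fun a : ℕ => a ^ k)).sum : ℕ) =
            -((n + 1).choose (i + 1) * ((i + 1 : ℕ) : ℤ) ^ k) *
                ((-1) ^ c.blocks.length * c.blocks.multinomial) -
              (n + 1).choose (i + 1) * ((-1) ^ c.blocks.length * c.blocks.multinomial *
                ((c.blocks.map (fun a : ℕ => a ^ k)).sum : ℕ)) := by
          intro c
          rw [signed_multinomial_cons, List.map_cons, List.sum_cons, Nat.cast_add, Nat.cast_pow]
          ring
        rw [Finset.sum_congr rfl fun c _ => hc c, Finset.sum_sub_distrib, ← Finset.mul_sum,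
          ← Finset.mul_sum, sum_signed_multinomial, ih (n - i) (by omega),
          neg_one_pow_sub (by omega)]
        simp only [hL]
        rw [neg_one_pow_sub (by omega)]
        ring
      rw [sum_composition_succ n fun l => (-1 : ℤ) ^ l.length * l.multinomial *
        ((l.map (fun a : ℕ => a ^ k)).sum : ℕ), Finset.sum_congr rfl fun i _ => hstep i,
        Finset.sum_add_distrib, ← Finset.sum_mul, ← Finset.mul_sum,
        Fin.sum_univ_eq_sum_range fun i =>
          (-1 : ℤ) ^ (i + 1) * (n + 1).choose (i + 1) * ((i + 1 : ℕ) : ℤ) ^ k,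
        Fin.sum_univ_eq_sum_range fun i => ((n + 1).choose (i + 1) : ℤ) * L (n - i),
        hpow, eq_sub_of_add_eq hsurj, ← mul_assoc, ← mul_pow]
      simp only [hL, neg_mul_neg, mul_one, one_pow, one_mul]
      ring

/-- `(-1)^{n-1} Σ_{j=1}^k (-1)^j Surj(k,j) C(n,j) = Σ_{α ⊨ n} (-1)^{ℓ(α)} (n choose α) α^k`. -/
theorem stmt10 (n k : ℕ) (hn : 1 ≤ n) (hk : 1 ≤ k) :
    (-1 : ℤ) ^ (n - 1) *
        ∑ j ∈ Finset.Icc 1 k, (-1 : ℤ) ^ j * numSurj k j * n.choose j =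
      ∑ α : Composition n, (-1 : ℤ) ^ α.length * compMultinomial α *
        (((α.blocks.map (fun a : ℕ => a ^ k)).sum : ℕ) : ℤ) := by
  have hp : ∀ α : Composition n, (-1 : ℤ) ^ α.length * compMultinomial α *
      (((α.blocks.map (fun a : ℕ => a ^ k)).sum : ℕ) : ℤ) =
      (-1 : ℤ) ^ α.blocks.length * α.blocks.multinomial *
        ((α.blocks.map (fun a : ℕ => a ^ k)).sum : ℕ) := by
    intro α
    rw [compMultinomial_eq, α.blocks_length]
  rw [Finset.sum_congr rfl fun α _ => hp α, sum_signed_multinomial_mul_sum_pow n k hk,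
    neg_one_pow_sub hn]
  ring
end

section
/- Let s ≥ 1 be an odd integer and let Γ be a simplicial complex on a finite vertex set V. Say that Γ is Eulerian (with respect to s) if for every nonempty subset A ⊆ V, Σ_{B} (−1)^{|B|} = 0, where the sum runs over all subsets B ⊆ A such that dim Γ_B < s and dim Γ_{A∖B} < s. Then Γ is Eulerian if and only if dim Γ < s. -/
open Finset

theorem dimSC_lt_iff {V : Type*} (Γ : Finset (Finset V)) (s : ℕ) :
    dimSC Γ < (s : ℤ) ↔ ∀ X ∈ Γ, X.card ≤ s := by
  rw [← Finset.sup_le_iff, dimSC]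
  omega

theorem dimSC_inducedSC_lt_iff {V : Type*} [DecidableEq V] (Γ : Finset (Finset V))
    (T : Finset V) (s : ℕ) :
    dimSC (inducedSC Γ T) < (s : ℤ) ↔ ∀ X ∈ Γ, (X ∩ T).card ≤ s := by
  simp [dimSC_lt_iff, inducedSC]

/-- Below a face with `s + 1` vertices, exactly the proper subsets induce complexes of
dimension less than `s`. -/
theorem dimSC_inducedSC_lt_iff_ne {V : Type*} [DecidableEq V] {Γ : Finset (Finset V)}
    {A B : Finset V} {s : ℕ} (hA : A ∈ Γ) (hcard : A.card = s + 1) (hB : B ⊆ A) :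
    dimSC (inducedSC Γ B) < (s : ℤ) ↔ B ≠ A := by
  rw [dimSC_inducedSC_lt_iff]
  constructor
  · rintro h rfl
    have := h B hA
    rw [inter_self] at this
    omega
  · intro hne X _
    have := card_lt_card (hB.ssubset_of_ne hne)
    have := card_le_card (inter_subset_right : X ∩ B ⊆ B)
    omega

/-- For odd `s`, a simplicial complex `Γ` is Eulerian (i.e. the Euler character identity
`ζ̄_s ζ_s (Γ_A) = ε(Γ_A)` holds for every nonempty `A ⊆ V`) if and only if `dim Γ < s`. -/
theorem stmt12 {V : Type*} [Fintype V] [DecidableEq V] (Γ : Finset (Finset V))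
    (hΓ : IsSimplicialComplex Γ) (s : ℕ) (hs : 1 ≤ s) (hsodd : Odd s) :
    (∀ A : Finset V, A.Nonempty →
        ∑ B ∈ A.powerset.filter
            (fun B => dimSC (inducedSC Γ B) < (s : ℤ) ∧
              dimSC (inducedSC Γ (A \ B)) < (s : ℤ)),
          (-1 : ℤ) ^ B.card = 0) ↔ dimSC Γ < (s : ℤ) := by
  constructor
  · intro h
    by_contra hdim
    rw [dimSC_lt_iff] at hdim
    push Not at hdim
    obtain ⟨X, hX, hXs⟩ := hdim
    obtain ⟨A, hAX, hcard⟩ := exists_subset_card_eq (show s + 1 ≤ X.card from hXs)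
    have hA : A ∈ Γ := hΓ.1 X hX A hAX
    have hne : A.Nonempty := card_pos.mp (by omega)
    have hfilter : A.powerset.filter
        (fun B => dimSC (inducedSC Γ B) < (s : ℤ) ∧
          dimSC (inducedSC Γ (A \ B)) < (s : ℤ)) = A.powerset \ {A, ∅} := by
      ext B
      simp only [mem_filter, mem_powerset, mem_sdiff, mem_insert, mem_singleton, not_or]
      refine and_congr_right fun hB => ?_
      rw [dimSC_inducedSC_lt_iff_ne hA hcard hB,
        dimSC_inducedSC_lt_iff_ne hA hcard sdiff_subset, Ne, Ne,
        Finset.sdiff_eq_self_iff_disjoint]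
      refine and_congr_right fun _ => not_congr ⟨fun hd => ?_, fun hd => ?_⟩
      · exact (disjoint_self_iff_empty B).mp (hd.mono_left hB)
      · simp [hd]
    have hsub : ({A, ∅} : Finset (Finset V)) ⊆ A.powerset := by
      simp [insert_subset_iff]
    have hsum := sum_sdiff (f := fun B : Finset V => (-1 : ℤ) ^ B.card) hsub
    rw [← hfilter, h A hne, sum_powerset_neg_one_pow_card_of_nonempty hne,
      sum_pair hne.ne_empty, hcard, hsodd.add_one.neg_one_pow] at hsum
    simp at hsum
  · intro hdim A hA
    rw [dimSC_lt_iff] at hdim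
    have hall (T : Finset V) : dimSC (inducedSC Γ T) < (s : ℤ) :=
      (dimSC_inducedSC_lt_iff Γ T s).2 fun X hX =>
        (card_le_card inter_subset_left).trans (hdim X hX)
    simpa [hall] using sum_powerset_neg_one_pow_card_of_nonempty hA
end
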